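/- With the closed form for p_k for odd k as above, for every odd integer k ≥ 5 we have p_k ≥ 2·arctan(1/3) > π√3/9. -/

import Mathlib

open Real

/-- The closed form for the mutual-edge probability `p_k` of the θ_k-graph
for odd `k ≥ 5`, as a function of a real parameter `k`. -/
noncomputable def pOdd (k : ℝ) : ℝ :=
  let γ : ℝ := 4 + 11 * Real.cos (2 * π / k) + Real.cos (6 * π / k)
  let α : ℝ := Real.sqrt
    ((27 * Real.cos (π / k) + 17 * Real.cos (3 * π / k) + 3 * Real.cos (5 * π / k) +
        Real.cos (7 * π / k)) * (Real.sin (π / k))⁻¹ / γ)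
  let β : ℝ := Real.sqrt
    (18 * Real.sin (2 * π / k) + 18 * Real.sin (4 * π / k) + 11 * Real.sin (6 * π / k) +
      Real.sin (8 * π / k) + Real.sin (10 * π / k))
  2 * (Real.arctan (2 * (Real.cos (π / k) + Real.cos (3 * π / k)) ^ 2 / (α * β)) +
        Real.arctan (4 * (2 * Real.cos (2 * π / k) + Real.sin (2 * π / k) ^ 2) / (α * β))) *
    (Real.tan (π / k))⁻¹ * β / (γ * α)

theorem arctan_seventh_lt : Real.arctan (7⁻¹) < 1 / 7 := by
  have h0 : 0 < Real.arctan (7⁻¹) := by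
    rw [Real.arctan_pos]; norm_num
  have h1 := Real.lt_tan h0 (Real.arctan_lt_pi_div_two _)
  rw [Real.tan_arctan] at h1
  linarith

theorem second_part : π * Real.sqrt 3 / 9 < 2 * Real.arctan (1 / 3) := by
  have h := Real.two_mul_arctan_inv_3_add_arctan_inv_7
  have h7 := arctan_seventh_lt
  have hs : Real.sqrt 3 < 1.7325 := by
    rw [Real.sqrt_lt' (by norm_num)]; norm_num
  have hp := Real.pi_gt_three
  have e : (1 / 3 : ℝ) = 3⁻¹ := by norm_num
  rw [e]
  nlinarith

/-- The sum of the two arctangents is at least `arctan (3/4)`. -/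
theorem arctan_part (w D : ℝ) (hw : 0 < w) (hD : 0 < D)
    (hD2 : D ^ 2 = 16 * (1 + w) * (1 + 2 * w) * (1 + 3 * w + w ^ 2 + w ^ 3)) :
    2 * Real.arctan (1 / 3) ≤
      Real.arctan (4 * w ^ 2 * (1 + w) / D) + Real.arctan (4 * (1 + 2 * w - w ^ 2) / D) := by
  have hden : 0 < D ^ 2 - 4 * w ^ 2 * (1 + w) * (4 * (1 + 2 * w - w ^ 2)) := by
    have : D ^ 2 - 4 * w ^ 2 * (1 + w) * (4 * (1 + 2 * w - w ^ 2))
        = 16 * (1 + w) * (1 + 3 * w) * (1 + 2 * w + w ^ 3) := by rw [hD2]; ring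
    rw [this]; positivity
  have hxy : 4 * w ^ 2 * (1 + w) / D * (4 * (1 + 2 * w - w ^ 2) / D) < 1 := by
    rw [div_mul_div_comm, div_lt_one (by positivity)]
    nlinarith
  rw [Real.arctan_add hxy, Real.two_mul_arctan (by norm_num) (by norm_num)]
  apply Real.arctan_mono
  have e : (4 * w ^ 2 * (1 + w) / D + 4 * (1 + 2 * w - w ^ 2) / D) /
      (1 - 4 * w ^ 2 * (1 + w) / D * (4 * (1 + 2 * w - w ^ 2) / D))
      = D / (4 * (1 + w) * (1 + 3 * w)) := by
    have h1 : 1 - 4 * w ^ 2 * (1 + w) / D * (4 * (1 + 2 * w - w ^ 2) / D)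
        = 16 * (1 + w) * (1 + 3 * w) * (1 + 2 * w + w ^ 3) / D ^ 2 := by
      field_simp
      rw [hD2]; ring
    have h2 : 4 * w ^ 2 * (1 + w) / D + 4 * (1 + 2 * w - w ^ 2) / D
        = 4 * (1 + 2 * w + w ^ 3) / D := by
      field_simp; ring
    rw [h1, h2]
    have : 0 < 1 + 2 * w + w ^ 3 := by positivity
    field_simp
    norm_num
  rw [e, le_div_iff₀ (by positivity)]
  refine (pow_le_pow_iff_left₀ (by positivity) (by positivity) two_ne_zero).1 ?_
  rw [hD2]
  have : 0 ≤ (1 + w) * ((1 - w) ^ 2 * (7 + 31 * w + 32 * w ^ 2)) := by positivity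
  nlinarith

theorem stmt_4 (k : ℕ) (hk : 5 ≤ k) (hko : Odd k) :
    2 * Real.arctan (1 / 3) ≤ pOdd k ∧ π * Real.sqrt 3 / 9 < 2 * Real.arctan (1 / 3) := by
  refine ⟨?_, second_part⟩
  have hk' : (5 : ℝ) ≤ k := by exact_mod_cast hk
  obtain ⟨t, ht⟩ : ∃ t : ℝ, t = π / k := ⟨_, rfl⟩
  have ht0 : 0 < t := by rw [ht]; positivity
  have ht5 : t ≤ π / 5 := by
    rw [ht]; exact div_le_div_of_nonneg_left pi_pos.le (by norm_num) hk'
  have hpi := Real.pi_pos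
  have hs : 0 < Real.sin t := Real.sin_pos_of_pos_of_lt_pi ht0 (by linarith)
  have hc : 0 < Real.cos t := Real.cos_pos_of_mem_Ioo ⟨by linarith, by linarith⟩
  have hw : 0 < Real.cos (2 * t) := Real.cos_pos_of_mem_Ioo ⟨by linarith, by linarith⟩
  have hw1 : Real.cos (2 * t) ≤ 1 := Real.cos_le_one _
  have hc2 : Real.cos t ^ 2 = (1 + Real.cos (2 * t)) / 2 := by
    rw [Real.cos_two_mul]; ring
  have hs2 : Real.sin (2 * t) ^ 2 = 1 - Real.cos (2 * t) ^ 2 := Real.sin_sq _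
  have hsd : Real.sin (2 * t) = 2 * Real.sin t * Real.cos t := Real.sin_two_mul t
  -- recurrences
  have rc : ∀ a : ℝ, Real.cos (a + 2 * t) = 2 * Real.cos (2 * t) * Real.cos a - Real.cos (a - 2 * t) := by
    intro a; rw [Real.cos_add, Real.cos_sub]; ring
  have rs : ∀ a : ℝ, Real.sin (a + 2 * t) = 2 * Real.cos (2 * t) * Real.sin a - Real.sin (a - 2 * t) := by
    intro a; rw [Real.sin_add, Real.sin_sub]; ring
  have c3 : Real.cos (3 * t) = Real.cos t * (2 * Real.cos (2 * t) - 1) := by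
    have := rc t
    rw [show t + 2 * t = 3 * t by ring, show t - 2 * t = -t by ring, Real.cos_neg] at this
    rw [this]; ring
  have c5 : Real.cos (5 * t) = Real.cos t * (4 * Real.cos (2 * t) ^ 2 - 2 * Real.cos (2 * t) - 1) := by
    have := rc (3 * t)
    rw [show 3 * t + 2 * t = 5 * t by ring, show 3 * t - 2 * t = t by ring, c3] at this
    rw [this]; ring
  have c7 : Real.cos (7 * t) = Real.cos t * (8 * Real.cos (2 * t) ^ 3 - 4 * Real.cos (2 * t) ^ 2
      - 4 * Real.cos (2 * t) + 1) := by
    have := rc (5 * t)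
    rw [show 5 * t + 2 * t = 7 * t by ring, show 5 * t - 2 * t = 3 * t by ring, c3, c5] at this
    rw [this]; ring
  have c6 : Real.cos (6 * t) = 4 * Real.cos (2 * t) ^ 3 - 3 * Real.cos (2 * t) := by
    rw [← Real.cos_three_mul]; congr 1; ring
  have s4 : Real.sin (4 * t) = Real.sin (2 * t) * (2 * Real.cos (2 * t)) := by
    have := rs (2 * t)
    rw [show 2 * t + 2 * t = 4 * t by ring, show 2 * t - 2 * t = 0 by ring, Real.sin_zero] at this
    rw [this]; ring
  have s6 : Real.sin (6 * t) = Real.sin (2 * t) * (4 * Real.cos (2 * t) ^ 2 - 1) := by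
    have := rs (4 * t)
    rw [show 4 * t + 2 * t = 6 * t by ring, show 4 * t - 2 * t = 2 * t by ring, s4] at this
    rw [this]; ring
  have s8 : Real.sin (8 * t) = Real.sin (2 * t) * (8 * Real.cos (2 * t) ^ 3 - 4 * Real.cos (2 * t)) := by
    have := rs (6 * t)
    rw [show 6 * t + 2 * t = 8 * t by ring, show 6 * t - 2 * t = 4 * t by ring, s4, s6] at this
    rw [this]; ring
  have s10 : Real.sin (10 * t) = Real.sin (2 * t) * (16 * Real.cos (2 * t) ^ 4
      - 12 * Real.cos (2 * t) ^ 2 + 1) := by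
    have := rs (8 * t)
    rw [show 8 * t + 2 * t = 10 * t by ring, show 8 * t - 2 * t = 6 * t by ring, s6, s8] at this
    rw [this]; ring
  simp only [pOdd, mul_div_assoc]
  rw [← ht, c3, c5, c7, c6, s4, s6, s8, s10, hs2, hsd, Real.tan_eq_sin_div_cos]
  generalize Real.cos (2 * t) = w at *
  generalize Real.cos t = c at *
  generalize Real.sin t = s at *
  set γ : ℝ := 4 + 11 * w + (4 * w ^ 3 - 3 * w) with hγ
  have hγe : γ = 4 * (1 + 2 * w + w ^ 3) := by rw [hγ]; ring
  have hγ0 : 0 < γ := by rw [hγe]; positivity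
  clear_value γ
  obtain ⟨A, hA⟩ : ∃ A : ℝ, A = 8 * c * (1 + 3 * w + w ^ 2 + w ^ 3) / (s * γ) := ⟨_, rfl⟩
  obtain ⟨B, hB⟩ : ∃ B : ℝ, B = 4 * s * c * γ * (1 + 2 * w) := ⟨_, rfl⟩
  have hA0 : 0 < A := by rw [hA]; positivity
  have hB0 : 0 < B := by rw [hB]; positivity
  have eA : (27 * c + 17 * (c * (2 * w - 1)) + 3 * (c * (4 * w ^ 2 - 2 * w - 1)) +
      c * (8 * w ^ 3 - 4 * w ^ 2 - 4 * w + 1)) * (s⁻¹ / γ) = A := by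
    rw [hA]; field_simp; ring
  have eB : 18 * (2 * s * c) + 18 * (2 * s * c * (2 * w)) + 11 * (2 * s * c * (4 * w ^ 2 - 1)) +
      2 * s * c * (8 * w ^ 3 - 4 * w) + 2 * s * c * (16 * w ^ 4 - 12 * w ^ 2 + 1) = B := by
    rw [hB, hγe]; ring
  have hAB : A * B = 16 * (1 + w) * (1 + 2 * w) * (1 + 3 * w + w ^ 2 + w ^ 3) := by
    have : A * B = 32 * c ^ 2 * (1 + 2 * w) * (1 + 3 * w + w ^ 2 + w ^ 3) := by
      rw [hA, hB]; field_simp; ring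
    rw [this, hc2]; ring
  have hα := Real.sqrt_pos.2 hA0
  have hβ := Real.sqrt_pos.2 hB0
  have key := arctan_part w (√A * √B) hw (by positivity)
    (by rw [mul_pow, Real.sq_sqrt hA0.le, Real.sq_sqrt hB0.le, hAB])
  have hM : 1 / 2 ≤ (s / c)⁻¹ * √B / (γ * √A) := by
    rw [le_div_iff₀ (by positivity)]
    refine (pow_le_pow_iff_left₀ (by positivity) (by positivity) two_ne_zero).1 ?_
    rw [mul_pow, mul_pow, mul_pow, Real.sq_sqrt hA0.le, Real.sq_sqrt hB0.le, hA, hB]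
    have e1 : (1 / 2) ^ 2 * (γ ^ 2 * (8 * c * (1 + 3 * w + w ^ 2 + w ^ 3) / (s * γ)))
        = 2 * γ * c / s * (1 + 3 * w + w ^ 2 + w ^ 3) := by
      field_simp; ring
    have e2 : (s / c)⁻¹ ^ 2 * (4 * s * c * γ * (1 + 2 * w))
        = 2 * γ * c / s * (2 * c ^ 2 * (1 + 2 * w)) := by
      field_simp; ring
    rw [e1, e2, hc2]
    apply mul_le_mul_of_nonneg_left _ (by positivity)
    nlinarith [mul_nonneg (sq_nonneg w) (sub_nonneg.2 hw1)]
  have hpos : 0 < Real.arctan (1 / 3) := by rw [Real.arctan_pos]; norm_num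
  have ex : 2 * ((c + c * (2 * w - 1)) ^ 2 / (√A * √B)) = 4 * w ^ 2 * (1 + w) / (√A * √B) := by
    rw [show (c + c * (2 * w - 1)) ^ 2 = 4 * w ^ 2 * c ^ 2 by ring, hc2]; ring
  have ey : 4 * ((2 * w + (1 - w ^ 2)) / (√A * √B)) = 4 * (1 + 2 * w - w ^ 2) / (√A * √B) := by
    ring
  rw [eA, eB, ex, ey]
  generalize Real.arctan (4 * w ^ 2 * (1 + w) / (√A * √B)) +
    Real.arctan (4 * (1 + 2 * w - w ^ 2) / (√A * √B)) = S at *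
  have := mul_le_mul key hM (by norm_num) (by linarith)
  calc 2 * Real.arctan (1 / 3) = 2 * (2 * Real.arctan (1 / 3) * (1 / 2)) := by ring
    _ ≤ 2 * (S * ((s / c)⁻¹ * √B / (γ * √A))) := by linarith
    _ = _ := by ring
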